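/- arXiv:2010.08734 — 3 statements merged into one kernel-verified Lean document; each statement's English description precedes it below -/
import Mathlib

section
/- Let m ≥ 2 and 1 ≤ s ≤ m be integers, let P ∈ 𝔽₂[X₂,…,X_m], let π : 𝔽₂^m → 𝔽₂^m be the permutation π(x₁,…,x_m) = (x₁ + P(x₂,…,x_m), x₂,…,x_m), and let L = {(x₁,…,x_s,0,…,0) : x_i ∈ 𝔽₂} ⊆ 𝔽₂^m. Then f_{(π,L)} : 𝔽₂^m × 𝔽₂^m → 𝔽₂ is a bent function on 𝔽₂^{2m}. -/
/-- Dot product on `𝔽₂^m`. -/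
def dotp {m : ℕ} (x y : Fin m → ZMod 2) : ZMod 2 := ∑ i, x i * y i

/-- `f : 𝔽₂^m × 𝔽₂^m → 𝔽₂` is bent: every Walsh–Hadamard coefficient is `±2^m`
(the dimension is `t = 2m`, so `2^{t/2} = 2^m`). -/
def IsBent2m {m : ℕ} (f : (Fin m → ZMod 2) × (Fin m → ZMod 2) → ZMod 2) : Prop :=
  ∀ a : (Fin m → ZMod 2) × (Fin m → ZMod 2),
    (∑ z : (Fin m → ZMod 2) × (Fin m → ZMod 2),
        (-1 : ℤ) ^ ((f z + dotp a.1 z.1 + dotp a.2 z.2).val)) = 2 ^ m ∨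
    (∑ z : (Fin m → ZMod 2) × (Fin m → ZMod 2),
        (-1 : ℤ) ^ ((f z + dotp a.1 z.1 + dotp a.2 z.2).val)) = -2 ^ m

/-- Carlet's function `f_{(π,L)}(x,y) = x·π(y) + 1_{L^⊥}(x)`. -/
noncomputable def fpl {m : ℕ} (π : (Fin m → ZMod 2) → (Fin m → ZMod 2))
    (L : Set (Fin m → ZMod 2)) (z : (Fin m → ZMod 2) × (Fin m → ZMod 2)) : ZMod 2 :=
  dotp z.1 (π z.2) +
    ({y : Fin m → ZMod 2 | ∀ x ∈ L, dotp x y = 0}).indicator (fun _ => 1) z.1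

/-- The additive character `c ↦ (-1)^c` of `𝔽₂`. -/
def signChar (c : ZMod 2) : ℤ := (-1) ^ c.val

lemma signChar_add (a b : ZMod 2) : signChar (a + b) = signChar a * signChar b := by
  revert a b; decide

lemma signChar_eq_or (a : ZMod 2) : signChar a = 1 ∨ signChar a = -1 := by
  revert a; decide

lemma signChar_sum {ι : Type*} (t : Finset ι) (f : ι → ZMod 2) :
    signChar (∑ i ∈ t, f i) = ∏ i ∈ t, signChar (f i) := by
  classical
  induction t using Finset.induction_on with
  | empty => simp [signChar]
  | insert i t hi ih => rw [Finset.sum_insert hi, Finset.prod_insert hi, signChar_add, ih]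

lemma dotp_add_left {m : ℕ} (x y z : Fin m → ZMod 2) :
    dotp (x + y) z = dotp x z + dotp y z := by
  simp [dotp, add_mul, Finset.sum_add_distrib]

lemma dotp_comm {m : ℕ} (x y : Fin m → ZMod 2) : dotp x y = dotp y x := by
  simp [dotp, mul_comm]

lemma sum_signChar_dotp {m : ℕ} (c : Fin m → ZMod 2) :
    ∑ y, signChar (dotp c y) = if c = 0 then 2 ^ m else 0 := by
  have h (a : ZMod 2) : ∑ t, signChar (a * t) = if a = 0 then 2 else 0 := by
    revert a; decide
  simp only [dotp, signChar_sum]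
  rw [← Fintype.prod_sum (fun i t => signChar (c i * t))]
  simp only [h]
  split_ifs with hc
  · simp [hc]
  · obtain ⟨i, hi⟩ := Function.ne_iff.mp hc
    exact Finset.prod_eq_zero (Finset.mem_univ i) (if_neg hi)

lemma add_eq_zero_iff_eq_zmod_two {m : ℕ} (x y : Fin m → ZMod 2) : x + y = 0 ↔ x = y := by
  have h (a b : ZMod 2) : a + b = 0 ↔ a = b := by revert a b; decide
  simp [funext_iff, h]

lemma sum_signChar_dotp_add {m : ℕ} (x b : Fin m → ZMod 2) :
    ∑ y, signChar (dotp x y + dotp b y) = if x = b then 2 ^ m else 0 := by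
  simp only [← dotp_add_left, sum_signChar_dotp, add_eq_zero_iff_eq_zmod_two]

/-- The Walsh coefficients of a Maiorana–McFarland function, for an involution `π`. -/
lemma sum_signChar_maioranaMcFarland {m : ℕ} {π : (Fin m → ZMod 2) → (Fin m → ZMod 2)}
    (hπ : Function.Involutive π) (a b : Fin m → ZMod 2) :
    ∑ x, ∑ y, signChar (dotp x (π y) + dotp a x + dotp b y) =
      2 ^ m * signChar (dotp b (π a)) := by
  rw [Finset.sum_comm]
  have h (y : Fin m → ZMod 2) :
      ∑ x, signChar (dotp x (π y) + dotp a x + dotp b y) =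
        if y = π a then 2 ^ m * signChar (dotp b y) else 0 := by
    simp only [signChar_add _ (dotp b y), ← Finset.sum_mul, dotp_comm _ (π y),
      sum_signChar_dotp_add, hπ.eq_iff, ite_mul, zero_mul]
  simp [h]

/-- If `π` is an involution and `x · π(y) = x · y` for all `x ∈ L^⊥`, then `f_{(π,L)}` is bent. -/
lemma isBent2m_fpl {m : ℕ} {π : (Fin m → ZMod 2) → (Fin m → ZMod 2)}
    (hπ : Function.Involutive π) (L : Set (Fin m → ZMod 2))
    (hL : ∀ x, (∀ l ∈ L, dotp l x = 0) → ∀ y, dotp x (π y) = dotp x y) :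
    IsBent2m (fpl π L) := by
  classical
  rintro ⟨a, b⟩
  set E : Set (Fin m → ZMod 2) := {y | ∀ x ∈ L, dotp x y = 0} with hE
  have hsplit (x y : Fin m → ZMod 2) :
      signChar (fpl π L (x, y) + dotp a x + dotp b y) =
        signChar (dotp x (π y) + dotp a x + dotp b y) -
          if x ∈ E then 2 * signChar (dotp a x) * signChar (dotp x y + dotp b y) else 0 := by
    have h1 : signChar 1 = -1 := rfl
    have h0 : signChar 0 = 1 := rfl
    by_cases hx : x ∈ E
    · simp only [fpl, ← hE, Set.indicator_of_mem hx, if_pos hx, hL x hx, signChar_add, h1]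
      ring
    · simp only [fpl, ← hE, Set.indicator_of_notMem hx, if_neg hx, signChar_add, h0]
      ring
  have hcorr (x : Fin m → ZMod 2) :
      (∑ y, if x ∈ E then 2 * signChar (dotp a x) * signChar (dotp x y + dotp b y) else 0) =
        if x = b then (if b ∈ E then 2 * signChar (dotp a b) * 2 ^ m else 0) else 0 := by
    by_cases hx : x ∈ E
    · simp only [if_pos hx, ← Finset.mul_sum, sum_signChar_dotp_add, mul_ite, mul_zero]
      exact ite_congr rfl (fun h => by rw [← h, if_pos hx]) fun _ => rfl
    · simp only [if_neg hx, Finset.sum_const_zero]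
      exact (ite_eq_right_iff.mpr fun h => if_neg (h ▸ hx)).symm
  have key : ∑ z : (Fin m → ZMod 2) × (Fin m → ZMod 2),
      signChar (fpl π L z + dotp a z.1 + dotp b z.2) =
        2 ^ m * signChar (dotp b (π a)) -
          if b ∈ E then 2 * signChar (dotp a b) * 2 ^ m else 0 := by
    simp only [Fintype.sum_prod_type, hsplit, Finset.sum_sub_distrib, hcorr,
      sum_signChar_maioranaMcFarland hπ, Finset.sum_ite_eq', Finset.mem_univ, if_true]
  simp only [signChar] at key ⊢
  rw [key]
  simp only [← signChar.eq_1]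
  by_cases hb : b ∈ E
  · rw [if_pos hb, hL b hb, dotp_comm a b]
    rcases signChar_eq_or (dotp b a) with h | h <;> rw [h]
    · right; ring
    · left; ring
  · rw [if_neg hb]
    rcases signChar_eq_or (dotp b (π a)) with h | h <;> rw [h]
    · left; ring
    · right; ring

lemma eval_update_of_mem_supported {σ R : Type*} [DecidableEq σ] [CommSemiring R] {i : σ}
    {P : MvPolynomial σ R} (hP : P ∈ MvPolynomial.supported R {j | j ≠ i}) (x : σ → R) (c : R) :
    MvPolynomial.eval (Function.update x i c) P = MvPolynomial.eval x P := by
  refine MvPolynomial.eval₂Hom_congr' rfl (fun j hj _ => ?_) rfl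
  exact Function.update_of_ne (MvPolynomial.mem_supported.mp hP hj) _ _

/-- for `L = {(x₁,…,x_s,0,…,0)}` and `π(x) = (x₁ + P(x₂,…,x_m), x₂,…,x_m)`,
the function `f_{(π,L)}` is bent on `𝔽₂^{2m}`. (Coordinates are 0-indexed.) -/
theorem stmt_7 (m s : ℕ) [NeZero m] (hm : 2 ≤ m) (hs1 : 1 ≤ s) (hsm : s ≤ m)
    (P : MvPolynomial (Fin m) (ZMod 2))
    (hP : P ∈ MvPolynomial.supported (ZMod 2) {i : Fin m | i ≠ 0}) :
    IsBent2m (fpl (fun x => Function.update x 0 (x 0 + MvPolynomial.eval x P))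
      {x : Fin m → ZMod 2 | ∀ j : Fin m, s ≤ (j : ℕ) → x j = 0}) := by
  refine isBent2m_fpl (fun x => ?_) _ fun x hx y => ?_
  · simp [eval_update_of_mem_supported hP, add_assoc, CharTwo.add_self_eq_zero]
  · have hx0 : x 0 = 0 := by
      have h := hx (Pi.single 0 1) fun j hj =>
        Pi.single_eq_of_ne (by rintro rfl; simp at hj; omega) _
      simpa [dotp, Pi.single_apply] using h
    refine Finset.sum_congr rfl fun i _ => ?_
    by_cases hi : i = 0
    · simp [hi, hx0]
    · simp [Function.update_of_ne hi]
end

section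
/- Let m ≥ 3 and 1 ≤ s ≤ m−2 be integers. The Boolean function f : 𝔽₂^m × 𝔽₂^m → 𝔽₂ defined by f(x,y) = ∑_{i=1}^{m} x_i y_i + ∏_{i=s+1}^{m}(x_i + 1) is a bent function on 𝔽₂^{2m}. -/
theorem neg_one_pow_val_add (a b : ZMod 2) :
    (-1 : ℤ) ^ (a + b).val = (-1) ^ a.val * (-1) ^ b.val := by
  revert a b; decide

theorem neg_one_pow_val_sum {ι : Type*} (s : Finset ι) (c : ι → ZMod 2) :
    (-1 : ℤ) ^ (∑ i ∈ s, c i).val = ∏ i ∈ s, (-1) ^ (c i).val := by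
  classical
  induction s using Finset.induction_on with
  | empty => simp
  | insert i s hi ih =>
    rw [Finset.sum_insert hi, Finset.prod_insert hi, neg_one_pow_val_add, ih]

/-- Orthogonality of the characters of `𝔽₂^m`. -/
theorem sum_neg_one_pow_dotp {m : ℕ} (c : Fin m → ZMod 2) :
    ∑ y : Fin m → ZMod 2, (-1 : ℤ) ^ (dotp c y).val = if c = 0 then 2 ^ m else 0 := by
  have hone : ∀ a : ZMod 2, ∑ t : ZMod 2, (-1 : ℤ) ^ (a * t).val = if a = 0 then 2 else 0 := by
    decide
  simp only [dotp, neg_one_pow_val_sum]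
  rw [← Fintype.prod_sum fun i t => (-1 : ℤ) ^ (c i * t).val]
  simp only [hone]
  split_ifs with hc
  · simp [hc]
  · obtain ⟨i, hi⟩ := Function.ne_iff.mp hc
    exact Finset.prod_eq_zero (Finset.mem_univ i) (if_neg hi)

/-- Every Maiorana–McFarland function `x · y + g(x)` is bent. -/
theorem isBent2m_dotp_add {m : ℕ} (g : (Fin m → ZMod 2) → ZMod 2) :
    IsBent2m (fun z : (Fin m → ZMod 2) × (Fin m → ZMod 2) => dotp z.1 z.2 + g z.1) := by
  rintro ⟨a, b⟩
  have hsplit : ∀ x y : Fin m → ZMod 2,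
      (-1 : ℤ) ^ (dotp x y + g x + dotp a x + dotp b y).val =
        (-1) ^ (g x + dotp a x).val * (-1) ^ (dotp (x + b) y).val := by
    intro x y
    rw [← neg_one_pow_val_add]
    congr 2
    simp only [dotp, Pi.add_apply, add_mul, Finset.sum_add_distrib]
    ring
  have hzero : ∀ x : Fin m → ZMod 2, x + b = 0 ↔ x = b := by
    intro x
    simp only [funext_iff, Pi.add_apply, Pi.zero_apply, CharTwo.add_eq_zero]
  have hsum : ∑ z : (Fin m → ZMod 2) × (Fin m → ZMod 2),
      (-1 : ℤ) ^ (dotp z.1 z.2 + g z.1 + dotp a z.1 + dotp b z.2).val =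
        (-1) ^ (g b + dotp a b).val * 2 ^ m := by
    simp [Fintype.sum_prod_type, hsplit, ← Finset.mul_sum, sum_neg_one_pow_dotp, hzero]
  dsimp only
  rw [hsum]
  rcases neg_one_pow_eq_or ℤ (g b + dotp a b).val with h | h <;> simp [h]

/-- for `m ≥ 3` and `1 ≤ s ≤ m−2`, the function
`f(x,y) = ∑_{i=1}^m x_i y_i + ∏_{i=s+1}^m (x_i + 1)` is bent on `𝔽₂^{2m}`.
(Coordinates are 0-indexed: `x_i` for `i ≥ s+1` has index `≥ s`.) -/
theorem stmt_13 (m s : ℕ) (hm : 3 ≤ m) (hs1 : 1 ≤ s) (hsm : s ≤ m - 2) :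
    IsBent2m (fun z : (Fin m → ZMod 2) × (Fin m → ZMod 2) =>
      dotp z.1 z.2 + ∏ i ∈ Finset.univ.filter (fun i : Fin m => s ≤ (i : ℕ)), (z.1 i + 1)) :=
  isBent2m_dotp_add fun x =>
    ∏ i ∈ Finset.univ.filter (fun i : Fin m => s ≤ (i : ℕ)), (x i + 1)
end

section
/- Let m ≥ 3 and 1 ≤ r ≤ s ≤ m−2 be integers, let L = {(0,…,0,x_{s+1},…,x_m) : x_i ∈ 𝔽₂} ⊆ 𝔽₂^m (first s coordinates zero), let π(x₁,…,x_m) = (x₁ + ∏_{i=r+1}^{m} x_i, x₂,…,x_m), and let f(x,y) = ∑_{i=1}^{m} x_i y_i + ∏_{i=s+1}^{m}(x_i + 1). Then the Hamming distance between f and f_{(π,L)}, i.e. the number of points of 𝔽₂^{2m} where they differ, equals 2^{m+r−1}. -/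
/-- The Maiorana–McFarland type bent function
`f(x,y) = ∑_{i=1}^m x_i y_i + ∏_{i=s+1}^m (x_i + 1)` (0-indexed coordinates). -/
def fM {m : ℕ} (s : ℕ) (z : (Fin m → ZMod 2) × (Fin m → ZMod 2)) : ZMod 2 :=
  dotp z.1 z.2 + ∏ i ∈ Finset.univ.filter (fun i : Fin m => s ≤ (i : ℕ)), (z.1 i + 1)

theorem ZMod.two_ne_zero_iff_eq_one (a : ZMod 2) : a ≠ 0 ↔ a = 1 := by
  revert a; decide

theorem ZMod.two_ne_zero_iff_add_one_eq_zero (a : ZMod 2) : a ≠ 0 ↔ a + 1 = 0 := by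
  revert a; decide

theorem prod_eq_one_iff_of_zmod_two {ι : Type*} (t : Finset ι) (g : ι → ZMod 2) :
    ∏ i ∈ t, g i = 1 ↔ ∀ i ∈ t, g i = 1 := by
  simp only [← ZMod.two_ne_zero_iff_eq_one, Finset.prod_ne_zero_iff]

/-- The number of binary vectors that are `1` on all coordinates satisfying `p`. -/
theorem card_filter_forall_eq_one {ι : Type*} [Fintype ι] [DecidableEq ι] (p : ι → Prop)
    [DecidablePred p] [DecidablePred fun y : ι → ZMod 2 => ∀ i, p i → y i = 1] :
    (Finset.univ.filter (fun y : ι → ZMod 2 => ∀ i, p i → y i = 1)).card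
      = 2 ^ (Finset.univ.filter (fun i => ¬ p i)).card := by
  have h : Finset.univ.filter (fun y : ι → ZMod 2 => ∀ i, p i → y i = 1)
      = Fintype.piFinset (fun i => if p i then ({1} : Finset (ZMod 2)) else Finset.univ) := by
    ext y
    simp only [Finset.mem_filter_univ, Fintype.mem_piFinset]
    refine forall_congr' fun i => ?_
    by_cases hi : p i <;> simp [hi]
  rw [h, Fintype.card_piFinset]
  have h2 : ∀ i, (if p i then ({1} : Finset (ZMod 2)) else Finset.univ).card
      = if ¬ p i then 2 else 1 := by
    intro i
    by_cases hi : p i <;> simp [hi, ZMod.card]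
  simp only [h2, ← Finset.prod_filter, Finset.prod_const]

/-- A vector is orthogonal to all vectors vanishing on the first `s` coordinates iff it vanishes
on the remaining ones. -/
theorem forall_dotp_eq_zero_iff {m : ℕ} (s : ℕ) (y : Fin m → ZMod 2) :
    (∀ x ∈ {x : Fin m → ZMod 2 | ∀ j : Fin m, (j : ℕ) < s → x j = 0}, dotp x y = 0)
      ↔ ∀ i : Fin m, s ≤ (i : ℕ) → y i = 0 := by
  constructor
  · intro h i hi
    have := h (Pi.single i 1) (fun j hj => Pi.single_eq_of_ne (by rintro rfl; omega) 1)
    simpa [dotp, Pi.single_apply] using this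
  · intro h x hx
    refine Finset.sum_eq_zero fun i _ => ?_
    rcases lt_or_ge (i : ℕ) s with hi | hi
    · rw [hx i hi, zero_mul]
    · rw [h i hi, mul_zero]

theorem indicator_orthogonal_eq_prod {m : ℕ} (s : ℕ) (x : Fin m → ZMod 2) :
    ({y : Fin m → ZMod 2 | ∀ x ∈ {x : Fin m → ZMod 2 | ∀ j : Fin m, (j : ℕ) < s → x j = 0},
      dotp x y = 0}).indicator (fun _ => (1 : ZMod 2)) x
      = ∏ i ∈ Finset.univ.filter (fun i : Fin m => s ≤ (i : ℕ)), (x i + 1) := by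
  simp only [forall_dotp_eq_zero_iff]
  by_cases h : ∀ i : Fin m, s ≤ (i : ℕ) → x i = 0
  · rw [Set.indicator_of_mem (by exact h)]
    symm
    refine Finset.prod_eq_one fun i hi => ?_
    rw [h i (by simpa using hi), zero_add]
  · rw [Set.indicator_of_notMem (by exact h)]
    push Not at h
    obtain ⟨i, hi, hx⟩ := h
    exact (Finset.prod_eq_zero (i := i) (by simpa using hi)
      ((ZMod.two_ne_zero_iff_add_one_eq_zero _).1 hx)).symm

theorem dotp_update_add {m : ℕ} (x y : Fin m → ZMod 2) (k : Fin m) (c : ZMod 2) :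
    dotp x (Function.update y k (y k + c)) = dotp x y + x k * c := by
  have h : ∀ i, x i * Function.update y k (y k + c) i
      = x i * y i + if i = k then x k * c else 0 := by
    intro i
    by_cases hi : i = k
    · subst hi; simp [mul_add]
    · simp [hi]
  simp [dotp, h, Finset.sum_add_distrib]

/-- the Hamming distance between `f` and `f_{(π,L)}` equals `2^{m+r−1}`. -/
theorem stmt_14 (m r s : ℕ) [NeZero m] (hm : 3 ≤ m) (hr : 1 ≤ r) (hrs : r ≤ s)
    (hsm : s ≤ m - 2) :
    (Finset.univ.filter (fun z : (Fin m → ZMod 2) × (Fin m → ZMod 2) =>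
      fM s z ≠ fpl (fun x : Fin m → ZMod 2 => Function.update x 0
          (x 0 + ∏ i ∈ Finset.univ.filter (fun i : Fin m => r ≤ (i : ℕ)), x i))
        {x : Fin m → ZMod 2 | ∀ j : Fin m, (j : ℕ) < s → x j = 0} z)).card
      = 2 ^ (m + r - 1) := by
  have key : ∀ z : (Fin m → ZMod 2) × (Fin m → ZMod 2),
      fM s z ≠ fpl (fun x : Fin m → ZMod 2 => Function.update x 0
          (x 0 + ∏ i ∈ Finset.univ.filter (fun i : Fin m => r ≤ (i : ℕ)), x i))
        {x : Fin m → ZMod 2 | ∀ j : Fin m, (j : ℕ) < s → x j = 0} z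
      ↔ (∀ i : Fin m, i = 0 → z.1 i = 1) ∧ ∀ i : Fin m, r ≤ (i : ℕ) → z.2 i = 1 := by
    intro z
    rw [fM, fpl, indicator_orthogonal_eq_prod, dotp_update_add, Ne, add_left_inj,
      left_eq_add, mul_eq_zero, not_or, ← Ne, ← Ne, ZMod.two_ne_zero_iff_eq_one,
      ZMod.two_ne_zero_iff_eq_one, prod_eq_one_iff_of_zmod_two]
    simp
  have hcard0 : (Finset.univ.filter (fun i : Fin m => ¬ i = 0)).card = m - 1 := by
    rw [Finset.filter_not, Finset.filter_eq' Finset.univ (0 : Fin m)]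
    simp [Finset.card_sdiff]
  have hcardr : (Finset.univ.filter (fun i : Fin m => ¬ r ≤ (i : ℕ))).card = r := by
    simp only [not_le, Fin.card_filter_val_lt]
    omega
  simp only [key]
  rw [← Finset.univ_product_univ, Finset.filter_product (fun x : Fin m → ZMod 2 => ∀ i, i = 0 → x i = 1)
      (fun y : Fin m → ZMod 2 => ∀ i : Fin m, r ≤ (i : ℕ) → y i = 1), Finset.card_product,
    card_filter_forall_eq_one (fun i : Fin m => i = 0),
    card_filter_forall_eq_one (fun i : Fin m => r ≤ (i : ℕ)), hcard0, hcardr, ← pow_add]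
  congr 1
  omega
end
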